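/- arXiv:1512.00962 — 2 statements merged into one kernel-verified Lean document; each statement's English description precedes it below -/
import Mathlib

section
/- Let q be an odd prime power, fix a nonzero y₀ ∈ F_{q^3} with Tr_{q^3/q}(y₀^2) = 0, and define D_{1,1} = {μ^2 · y · Tr_{q^3/q}(y₀ y) : μ ∈ F_q^×, y ∈ F_{q^3}^×, Tr_{q^3/q}(y^2) = 0, Tr_{q^3/q}(y₀ y) ≠ 0} ∪ {2μ^2 y₀ : μ ∈ F_q^×}. Let ψ be the canonical additive character of F_{q^3}, η the quadratic character of F_q, and G_q(η) the Gauss sum of η. Then for every nonzero a ∈ F_{q^3}, the sum Σ_{x∈D_{1,1}} ψ(ax) equals: (-1 + η(2)·q·G_q(η))/2 if Tr_{q^3/q}(a^2) = 0 and a ∈ D_{1,1}; (-1 - η(2)·q·G_q(η))/2 if Tr_{q^3/q}(a^2) = 0 and a ∉ D_{1,1}; (-1 + εq)/2 if Tr_{q^3/q}(a^2) is a nonzero square in F_q; and (-1 - εq)/2 if Tr_{q^3/q}(a^2) is a nonsquare in F_q. Here ε = 1 if q ≡ 1 (mod 4) and ε = -1 if q ≡ 3 (mod 4). In particular, D_{1,1}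 takes exactly four nontrivial additive character values. -/
open scoped Classical

section CharacterSums

variable {K : Type*} [Field K] [Fintype K]

theorem MulChar.eq_quadraticChar_of_orderOf_eq_two {η : MulChar K ℂ} (hη : orderOf η = 2) :
    η = (quadraticChar K).ringHomComp (Int.castRingHom ℂ) := by
  have hsq : η ^ 2 = 1 := hη ▸ pow_orderOf_eq_one η
  have hone : η ≠ 1 := fun h => by simp [h] at hη
  have hvalue : ∀ x : K, x ≠ 0 → η x * η x = 1 := fun x hx => by
    have := congrArg (fun χ : MulChar K ℂ => χ x) hsq
    simpa [MulChar.pow_apply' η two_ne_zero, MulChar.one_apply, hx, pow_two] using this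
  have hsquare : ∀ x : K, x ≠ 0 → IsSquare x → η x = 1 := by
    rintro _ hx ⟨y, rfl⟩
    rw [map_mul]
    exact hvalue y (left_ne_zero_of_mul hx)
  have hnonsquare : ∀ x : K, ¬ IsSquare x → η x = -1 := by
    intro x hx
    have hx0 : x ≠ 0 := fun h => hx (h ▸ IsSquare.zero)
    rcases mul_self_eq_one_iff.mp (hvalue x hx0) with h | h
    swap
    · exact h
    refine absurd (MulChar.ext' fun y => ?_) hone
    by_cases hy0 : y = 0
    · simp [hy0]
    rw [MulChar.one_apply (isUnit_iff_ne_zero.mpr hy0)]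
    by_cases hy : IsSquare y
    · exact hsquare y hy0 hy
    · have hxy : IsSquare (x * y) := by
        rw [← quadraticChar_one_iff_isSquare (mul_ne_zero hx0 hy0), map_mul,
          quadraticChar_neg_one_iff_not_isSquare.mpr hx,
          quadraticChar_neg_one_iff_not_isSquare.mpr hy]
        norm_num
      have := hsquare _ (mul_ne_zero hx0 hy0) hxy
      rwa [map_mul, h, one_mul] at this
  refine MulChar.ext' fun x => ?_
  rw [MulChar.ringHomComp_apply]
  by_cases hx0 : x = 0
  · simp [hx0]
  by_cases hx : IsSquare x
  · rw [hsquare x hx0 hx, (quadraticChar_one_iff_isSquare hx0).mpr hx]; simp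
  · rw [hnonsquare x hx, quadraticChar_neg_one_iff_not_isSquare.mpr hx]; simp

/-- The quadratic character of a finite field with complex values. -/
noncomputable def complexQuadraticChar (K : Type*) [Field K] [Fintype K] : MulChar K ℂ :=
  (quadraticChar K).ringHomComp (Int.castRingHom ℂ)

theorem complexQuadraticChar_apply (x : K) :
    complexQuadraticChar K x = ((quadraticChar K x : ℤ) : ℂ) := rfl

theorem complexQuadraticChar_of_isSquare {x : K} (hx0 : x ≠ 0) (hx : IsSquare x) :
    complexQuadraticChar K x = 1 := by
  rw [complexQuadraticChar_apply, (quadraticChar_one_iff_isSquare hx0).mpr hx, Int.cast_one]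

theorem complexQuadraticChar_of_not_isSquare {x : K} (hx : ¬ IsSquare x) :
    complexQuadraticChar K x = -1 := by
  rw [complexQuadraticChar_apply, quadraticChar_neg_one_iff_not_isSquare.mpr hx]; simp

theorem complexQuadraticChar_mul_self {x : K} (hx : x ≠ 0) :
    complexQuadraticChar K x * complexQuadraticChar K x = 1 := by
  rw [← map_mul]
  exact complexQuadraticChar_of_isSquare (mul_ne_zero hx hx) ⟨x, rfl⟩

theorem complexQuadraticChar_neg_one (hK : ringChar K ≠ 2) :
    complexQuadraticChar K (-1) = if Fintype.card K % 4 = 1 then 1 else -1 := by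
  have hodd := FiniteField.odd_card_of_char_ne_two hK
  split_ifs with h
  · exact complexQuadraticChar_of_isSquare (by simp)
      (FiniteField.isSquare_neg_one_iff.mpr (by omega))
  · exact complexQuadraticChar_of_not_isSquare
      (FiniteField.isSquare_neg_one_iff.not.mpr (by omega))

variable {ψ : AddChar K ℂ}

theorem gaussSum_complexQuadraticChar_sq (hK : ringChar K ≠ 2) (hψ : ψ.IsPrimitive) :
    gaussSum (complexQuadraticChar K) ψ ^ 2 = complexQuadraticChar K (-1) * Fintype.card K := by
  refine gaussSum_sq (fun h => ?_) ((quadraticChar_isQuadratic K).comp _) hψ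
  obtain ⟨a, ha⟩ := quadraticChar_exists_neg_one' hK
  have := congrArg (fun χ : MulChar K ℂ => χ a) h
  rw [MulChar.ringHomComp_apply, ha, MulChar.one_apply_coe] at this
  norm_num at this

theorem sum_addChar_mul (hψ : ψ.IsPrimitive) {c : K} (hc : c ≠ 0) : ∑ x, ψ (c * x) = 0 := by
  simpa [hc, mul_comm] using AddChar.sum_mulShift c hψ

theorem sum_addChar_mul_sq (hK : ringChar K ≠ 2) (hψ : ψ.IsPrimitive) {c : K} (hc : c ≠ 0) :
    ∑ x, ψ (c * x ^ 2) = complexQuadraticChar K c * gaussSum (complexQuadraticChar K) ψ := by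
  have hfiber : ∑ x, ψ (c * x ^ 2) = ∑ y, (complexQuadraticChar K y + 1) * ψ (c * y) := by
    rw [← Finset.sum_fiberwise Finset.univ (fun x : K => x ^ 2)]
    refine Finset.sum_congr rfl fun y _ => ?_
    have hcard := quadraticChar_card_sqrts hK y
    rw [complexQuadraticChar_apply, ← Int.cast_one, ← Int.cast_add, ← hcard,
      Finset.sum_congr rfl (g := fun _ => ψ (c * y)), Finset.sum_const, nsmul_eq_mul]
    · rw [Int.cast_natCast]
      congr 3
      ext; simp
    · intro x hx
      rw [(Finset.mem_filter.mp hx).2]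
  rw [hfiber, ← gaussSum_mulShift _ ψ (Units.mk0 c hc)]
  simp only [add_mul, one_mul, Finset.sum_add_distrib, sum_addChar_mul hψ hc, add_zero,
    Units.val_mk0, ← mul_assoc, complexQuadraticChar_mul_self hc]
  simp [gaussSum, AddChar.mulShift_apply]

theorem sum_addChar_binaryQuadraticForm_of_ne_zero (hK : ringChar K ≠ 2) (hψ : ψ.IsPrimitive)
    {A : K} (B C : K) (hA : A ≠ 0) :
    ∑ t, ∑ s, ψ (A * s ^ 2 + 2 * B * s * t + C * t ^ 2) =
      complexQuadraticChar K A * gaussSum (complexQuadraticChar K) ψ *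
        ∑ t, ψ ((A * C - B ^ 2) / A * t ^ 2) := by
  rw [Finset.mul_sum]
  refine Finset.sum_congr rfl fun t _ => ?_
  rw [← sum_addChar_mul_sq hK hψ hA, Finset.sum_mul,
    ← Equiv.sum_comp (Equiv.addRight (B / A * t)) fun x => ψ (A * x ^ 2) * _]
  refine Finset.sum_congr rfl fun s _ => ?_
  rw [← AddChar.map_add_eq_mul, Equiv.coe_addRight]
  congr 1
  field_simp
  ring

theorem sum_addChar_binaryQuadraticForm (hK : ringChar K ≠ 2) (hψ : ψ.IsPrimitive)
    {A B C : K} (hD : A * C - B ^ 2 ≠ 0) :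
    ∑ t, ∑ s, ψ (A * s ^ 2 + 2 * B * s * t + C * t ^ 2) =
      complexQuadraticChar K (-1) * complexQuadraticChar K (A * C - B ^ 2) * Fintype.card K := by
  by_cases hA : A = 0
  · subst hA
    have h2 : (2 : K) ≠ 0 := Ring.two_ne_zero hK
    have hB : B ≠ 0 := fun h => hD (by simp [h])
    rw [← map_mul, complexQuadraticChar_of_isSquare (mul_ne_zero (by simp) hD) ⟨B, by ring⟩,
      Finset.sum_eq_single 0]
    · simp
    · intro t _ ht
      have hsplit : ∀ s, ψ (0 * s ^ 2 + 2 * B * s * t + C * t ^ 2) =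
          ψ (2 * B * t * s) * ψ (C * t ^ 2) := fun s => by
        rw [← AddChar.map_add_eq_mul]; ring_nf
      simp_rw [hsplit, ← Finset.sum_mul,
        sum_addChar_mul hψ (mul_ne_zero (mul_ne_zero h2 hB) ht), zero_mul]
    · simp
  · have hAD : A * ((A * C - B ^ 2) / A) = A * C - B ^ 2 := mul_div_cancel₀ _ hA
    rw [sum_addChar_binaryQuadraticForm_of_ne_zero hK hψ B C hA,
      sum_addChar_mul_sq hK hψ (div_ne_zero hD hA)]
    have hmul : complexQuadraticChar K (A * C - B ^ 2) = complexQuadraticChar K A *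
        complexQuadraticChar K ((A * C - B ^ 2) / A) := by rw [← map_mul, hAD]
    rw [hmul]
    linear_combination complexQuadraticChar K A * complexQuadraticChar K ((A * C - B ^ 2) / A) *
      gaussSum_complexQuadraticChar_sq hK hψ

theorem sum_addChar_degenerate_binaryQuadraticForm (hK : ringChar K ≠ 2) (hψ : ψ.IsPrimitive)
    {A B C : K} (hA : A ≠ 0) (hD : A * C - B ^ 2 = 0) :
    ∑ t, ∑ s, ψ (A * s ^ 2 + 2 * B * s * t + C * t ^ 2) =
      complexQuadraticChar K A * Fintype.card K * gaussSum (complexQuadraticChar K) ψ := by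
  rw [sum_addChar_binaryQuadraticForm_of_ne_zero hK hψ B C hA, hD]
  simp
  ring

end CharacterSums

section Trace

variable {K L : Type*} [Field K] [Fintype K] [Field L] [Fintype L] [Algebra K L]

/-- An isotropic vector of the trace form of a cubic extension of finite fields can be completed
to a basis for which the trace form is `2 u v - w ^ 2`. -/
theorem exists_trace_dual_basis (h2 : (2 : K) ≠ 0)
    (hL : Fintype.card L = Fintype.card K ^ 3) {e : L} (he : e ≠ 0)
    (hee : Algebra.trace K L (e * e) = 0) :
    ∃ f g : L, Algebra.trace K L (e * f) = 1 ∧ Algebra.trace K L (f * f) = 0 ∧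
      Algebra.trace K L (e * g) = 0 ∧ Algebra.trace K L (f * g) = 0 ∧
      Algebra.trace K L (g * g) = -1 ∧
      ∀ a : L, a = Algebra.trace K L (a * f) • e + Algebra.trace K L (a * e) • f -
        Algebra.trace K L (a * g) • g := by
  have hrank : Module.finrank K L = 3 := by
    have := Module.card_eq_pow_finrank (K := K) (V := L)
    rw [hL] at this
    exact (Nat.pow_right_injective Fintype.one_lt_card this).symm
  have htr : ∀ x : L, algebraMap K L (Algebra.trace K L x) =
      x + x ^ Fintype.card K + (x ^ Fintype.card K) ^ Fintype.card K := fun x => by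
    rw [FiniteField.algebraMap_trace_eq_sum_pow, hrank]
    simp [Finset.sum_range_succ, Nat.card_eq_fintype_card, pow_two, pow_mul]
  let σ : L →ₐ[K] L := FiniteField.frobeniusAlgHom K L
  have hσ : ∀ x, σ x = x ^ Fintype.card K := fun x => rfl
  have hσ3 : ∀ x, σ (σ (σ x)) = x := fun x => by
    rw [hσ, hσ, hσ, ← pow_mul, ← pow_mul, ← pow_three, ← hL, FiniteField.pow_card]
  replace htr : ∀ x : L, algebraMap K L (Algebra.trace K L x) = x + σ x + σ (σ x) := htr
  obtain ⟨w, hw⟩ := Algebra.trace_surjective K L 1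
  obtain ⟨h, heh⟩ : ∃ h : L, Algebra.trace K L (e * h) = 1 :=
    ⟨e⁻¹ * w, by rw [mul_inv_cancel_left₀ he, hw]⟩
  obtain ⟨f, hef, hff⟩ : ∃ f : L, Algebra.trace K L (e * f) = 1 ∧
      Algebra.trace K L (f * f) = 0 := by
    refine ⟨h - (Algebra.trace K L (h * h) / 2) • e, ?_, ?_⟩
    · rw [mul_sub, mul_smul_comm, map_sub, map_smul, hee, heh]; simp
    · rw [sub_mul, mul_sub, mul_sub, mul_smul_comm, smul_mul_assoc, smul_mul_assoc, mul_smul_comm,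
        map_sub, map_sub, map_sub, map_smul, map_smul, map_smul, map_smul, hee, mul_comm h e, heh]
      simp only [smul_eq_mul]
      field_simp
      ring
  have tee := htr (e * e)
  have tef := htr (e * f)
  have tff := htr (f * f)
  rw [hee] at tee
  rw [hef] at tef
  rw [hff] at tff
  simp only [map_mul, map_zero, map_one] at tee tef tff
  let g := σ e * σ (σ f) - σ (σ e) * σ f
  have hσg : σ g = σ (σ e) * f - e * σ (σ f) := by simp [g, hσ3]
  have hσσg : σ (σ g) = e * σ f - σ e * f := by simp [hσg, hσ3]
  have hinj := (algebraMap K L).injective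
  have heg : Algebra.trace K L (e * g) = 0 := hinj <| by
    rw [htr, map_mul, map_mul, hσσg, hσg, map_zero]; ring
  have hfg : Algebra.trace K L (f * g) = 0 := hinj <| by
    rw [htr, map_mul, map_mul, hσσg, hσg, map_zero]; ring
  have hgg : Algebra.trace K L (g * g) = -1 := hinj <| by
    rw [htr, map_mul, map_mul, hσσg, hσg, map_neg, map_one]
    simp only [g]
    generalize σ (σ e) = e2 at *
    generalize σ (σ f) = f2 at *
    generalize σ e = e1 at *
    generalize σ f = f1 at *
    linear_combination -(f * f + f1 * f1 + f2 * f2) * tee + (1 + (e * f + e1 * f1 + e2 * f2)) * tef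
  have teg := htr (e * g)
  have tfg := htr (f * g)
  have tgg := htr (g * g)
  rw [heg] at teg
  rw [hfg] at tfg
  rw [hgg] at tgg
  simp only [map_mul, map_zero, map_one, map_neg] at teg tfg tgg
  refine ⟨f, g, hef, hff, heg, hfg, hgg, fun a => ?_⟩
  let N : Matrix (Fin 3) (Fin 3) L :=
    !![e, σ e, σ (σ e); f, σ f, σ (σ f); g, σ g, σ (σ g)]
  let N' : Matrix (Fin 3) (Fin 3) L :=
    !![f, e, -g; σ f, σ e, -σ g; σ (σ f), σ (σ e), -σ (σ g)]
  have hNN : N * N' = 1 := by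
    ext i j
    fin_cases i <;> fin_cases j <;>
      simp [N, N', Matrix.mul_apply, Fin.sum_univ_three] <;>
      grobner
  have hN'N := mul_eq_one_comm.mp hNN
  have h0 := congrFun (congrFun hN'N 0) 0
  have h1 := congrFun (congrFun hN'N 1) 0
  have h2 := congrFun (congrFun hN'N 2) 0
  simp [N, N', Matrix.mul_apply, Fin.sum_univ_three] at h0 h1 h2
  simp only [Algebra.smul_def, htr, map_mul]
  linear_combination -a * h0 - σ a * h1 - σ (σ a) * h2

end Trace

section HalfCone

/-- A sum over the image of the nonzero vectors under a map whose fibres are `{v, -v}`. -/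
theorem sum_comp_eq_add_two_mul_sum {V X : Type*} [AddCommGroup V] [Fintype V] [Fintype X]
    (hV : ∀ v : V, v = -v → v = 0) {φ : V → X} (hφ : ∀ v w, φ w = φ v ↔ w = v ∨ w = -v)
    {D : Set X} (hD : ∀ x, x ∈ D ↔ ∃ v, v ≠ 0 ∧ φ v = x) (F : X → ℂ) :
    ∑ v, F (φ v) = F (φ 0) + 2 * ∑ x ∈ Finset.univ.filter (· ∈ D), F x := by
  rw [← Finset.add_sum_erase _ _ (Finset.mem_univ (0 : V)), Finset.mul_sum,
    ← Finset.sum_fiberwise_of_maps_to (t := Finset.univ.filter (· ∈ D)) (g := φ)]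
  · congr 1
    refine Finset.sum_congr rfl fun x hx => ?_
    obtain ⟨v, hv, rfl⟩ := (hD x).mp (Finset.mem_filter.mp hx).2
    have hfiber : (Finset.univ.erase (0 : V)).filter (φ · = φ v) = {v, -v} := by
      ext w
      simp only [Finset.mem_filter, Finset.mem_erase, Finset.mem_univ, and_true, hφ,
        Finset.mem_insert, Finset.mem_singleton, and_iff_right_iff_imp]
      rintro (rfl | rfl)
      · exact hv
      · exact neg_ne_zero.mpr hv
    rw [hfiber, Finset.sum_pair fun h => hv (hV v h), (hφ v (-v)).mpr (Or.inr rfl), two_mul]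
  · intro v hv
    exact Finset.mem_filter.mpr
      ⟨Finset.mem_univ _, (hD _).mpr ⟨v, (Finset.mem_erase.mp hv).1, rfl⟩⟩

variable {K L : Type*} [Field K] [Field L] [Algebra K L]

/-- The quadratic parametrization of a half-cone of the form `2 u v - w ^ 2`. -/
def halfConeParam (e f g : L) (v : K × K) : L :=
  (2 * v.2 ^ 2) • e + v.1 ^ 2 • f + (2 * v.1 * v.2) • g

theorem trace_mul_halfConeParam (a e f g : L) (v : K × K) :
    Algebra.trace K L (a * halfConeParam e f g v) =
      2 * v.2 ^ 2 * Algebra.trace K L (a * e) + v.1 ^ 2 * Algebra.trace K L (a * f) +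
        2 * v.1 * v.2 * Algebra.trace K L (a * g) := by
  simp [halfConeParam, mul_add]

variable {e f g : L}

theorem halfConeParam_eq_iff (h2 : (2 : K) ≠ 0)
    (hee : Algebra.trace K L (e * e) = 0) (hef : Algebra.trace K L (e * f) = 1)
    (hff : Algebra.trace K L (f * f) = 0) (heg : Algebra.trace K L (e * g) = 0)
    (hfg : Algebra.trace K L (f * g) = 0) (hgg : Algebra.trace K L (g * g) = -1)
    (v w : K × K) : halfConeParam e f g w = halfConeParam e f g v ↔ w = v ∨ w = -v := by
  obtain ⟨s, t⟩ := v
  obtain ⟨s', t'⟩ := w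
  constructor
  · intro h
    have htrace : ∀ a : L, _ := fun a => congrArg (fun x => Algebra.trace K L (a * x)) h
    simp only [trace_mul_halfConeParam] at htrace
    have h1 := htrace e
    have h3 := htrace f
    have h4 := htrace g
    rw [hee, hef, heg] at h1
    rw [mul_comm f e, hef, hff, hfg] at h3
    rw [mul_comm g e, mul_comm g f, heg, hfg, hgg] at h4
    have hs : s' ^ 2 = s ^ 2 := by linear_combination h1
    have ht : t' ^ 2 = t ^ 2 := mul_left_cancel₀ h2 (by linear_combination h3)
    have hst : s' * t' = s * t := mul_left_cancel₀ h2 (by linear_combination -h4)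
    simp only [Prod.mk.injEq, Prod.neg_mk]
    by_cases hs0 : s = 0
    · subst hs0
      have hs0' : s' = 0 := by simpa using hs
      rcases sq_eq_sq_iff_eq_or_eq_neg.mp ht with h | h
      · exact Or.inl ⟨hs0', h⟩
      · exact Or.inr ⟨by simpa using hs0', h⟩
    · rcases sq_eq_sq_iff_eq_or_eq_neg.mp hs with h | h
      · exact Or.inl ⟨h, mul_left_cancel₀ hs0 (by rw [← hst, h])⟩
      · exact Or.inr ⟨h, mul_left_cancel₀ hs0 (by rw [mul_neg, ← hst, h]; ring)⟩
  · rintro (h | h)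
    · rw [h]
    · rw [h]; simp [halfConeParam]

theorem trace_sq_eq_of_dual_basis (hbasis : ∀ a : L, a = Algebra.trace K L (a * f) • e +
      Algebra.trace K L (a * e) • f - Algebra.trace K L (a * g) • g) (a : L) :
    Algebra.trace K L (a ^ 2) = Algebra.trace K L (a * f) * (2 * Algebra.trace K L (a * e)) -
      Algebra.trace K L (a * g) ^ 2 := by
  rw [pow_two]
  nth_rewrite 2 [hbasis a]
  rw [mul_sub, mul_add, map_sub, map_add, mul_smul_comm, mul_smul_comm, mul_smul_comm, map_smul,
    map_smul, map_smul]
  simp only [smul_eq_mul]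
  ring

theorem exists_halfConeParam_iff (h2 : (2 : K) ≠ 0)
    (hee : Algebra.trace K L (e * e) = 0) (hef : Algebra.trace K L (e * f) = 1)
    (hff : Algebra.trace K L (f * f) = 0) (heg : Algebra.trace K L (e * g) = 0)
    (hfg : Algebra.trace K L (f * g) = 0) (hgg : Algebra.trace K L (g * g) = -1)
    (hbasis : ∀ a : L, a = Algebra.trace K L (a * f) • e +
      Algebra.trace K L (a * e) • f - Algebra.trace K L (a * g) • g) (x : L) :
    ((∃ μ : K, μ ≠ 0 ∧ ∃ y : L, y ≠ 0 ∧ Algebra.trace K L (y ^ 2) = 0 ∧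
          Algebra.trace K L (e * y) ≠ 0 ∧
          x = algebraMap K L (μ ^ 2) * y * algebraMap K L (Algebra.trace K L (e * y))) ∨
        (∃ μ : K, μ ≠ 0 ∧ x = 2 * algebraMap K L (μ ^ 2) * e)) ↔
      ∃ v : K × K, v ≠ 0 ∧ halfConeParam e f g v = x := by
  constructor
  · rintro (⟨μ, hμ, y, -, hy, hey, rfl⟩ | ⟨μ, hμ, rfl⟩)
    · rw [trace_sq_eq_of_dual_basis hbasis] at hy
      rw [mul_comm e y] at hey ⊢
      have hyb := hbasis y
      set P := Algebra.trace K L (y * e)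
      set R := Algebra.trace K L (y * f)
      set S := Algebra.trace K L (y * g)
      refine ⟨(μ * P, -(μ * S / 2)), fun h => mul_ne_zero hμ hey (congrArg Prod.fst h), ?_⟩
      have h1 : 2 * (-(μ * S / 2)) ^ 2 = μ ^ 2 * P * R := by
        field_simp
        linear_combination -hy
      have h3 : 2 * (μ * P) * (-(μ * S / 2)) = -(μ ^ 2 * P * S) := by field_simp
      rw [hyb, halfConeParam]
      simp only [h1, h3, Algebra.smul_def, map_mul, map_pow, map_neg]
      ring
    · refine ⟨(0, μ), fun h => hμ (congrArg Prod.snd h), ?_⟩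
      simp [halfConeParam, Algebra.smul_def, map_ofNat (algebraMap K L)]
  · rintro ⟨⟨s, t⟩, hst, rfl⟩
    by_cases hs : s = 0
    · subst hs
      refine Or.inr ⟨t, fun ht => hst (by simp [ht]), ?_⟩
      simp [halfConeParam, Algebra.smul_def, map_ofNat (algebraMap K L)]
    · have htrace : ∀ a : L, _ := fun a => trace_mul_halfConeParam a e f g (s, t)
      have he := htrace e
      have hf := htrace f
      have hg := htrace g
      simp only [hee, hef, heg] at he
      simp only [mul_comm f e, hef, hff, hfg] at hf
      simp only [mul_comm g e, mul_comm g f, heg, hfg, hgg] at hg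
      set y := halfConeParam e f g (s, t)
      have hey : Algebra.trace K L (e * y) = s ^ 2 := by rw [he]; ring
      have hey0 : Algebra.trace K L (e * y) ≠ 0 := hey ▸ pow_ne_zero 2 hs
      refine Or.inl ⟨s⁻¹, inv_ne_zero hs, y, fun h => hey0 (by simp [h]), ?_, hey0, ?_⟩
      · rw [trace_sq_eq_of_dual_basis hbasis, mul_comm y e, mul_comm y f, mul_comm y g, he, hf, hg]
        ring
      · rw [hey, mul_right_comm, ← map_mul, ← mul_pow, inv_mul_cancel₀ hs]
        simp

end HalfCone

section Main

variable {K L : Type*} [Field K] [Fintype K] [Field L] [Algebra K L] {e f g : L}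

theorem sum_addChar_trace_mul_halfConeParam_of_ne_zero (hK : ringChar K ≠ 2) {ψ : AddChar K ℂ}
    (hψ : ψ.IsPrimitive) (hbasis : ∀ a : L, a = Algebra.trace K L (a * f) • e +
      Algebra.trace K L (a * e) • f - Algebra.trace K L (a * g) • g)
    {a : L} (ha : Algebra.trace K L (a ^ 2) ≠ 0) :
    ∑ v : K × K, ψ (Algebra.trace K L (a * halfConeParam e f g v)) =
      complexQuadraticChar K (-1) * complexQuadraticChar K (Algebra.trace K L (a ^ 2)) *
        Fintype.card K := by
  rw [trace_sq_eq_of_dual_basis hbasis] at ha ⊢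
  rw [← sum_addChar_binaryQuadraticForm hK hψ ha, Fintype.sum_prod_type_right]
  refine Finset.sum_congr rfl fun t _ => Finset.sum_congr rfl fun s _ => ?_
  rw [trace_mul_halfConeParam]
  ring_nf

theorem sum_addChar_trace_mul_halfConeParam_of_eq_zero (hK : ringChar K ≠ 2) {ψ : AddChar K ℂ}
    (hψ : ψ.IsPrimitive) (hbasis : ∀ a : L, a = Algebra.trace K L (a * f) • e +
      Algebra.trace K L (a * e) • f - Algebra.trace K L (a * g) • g)
    (hee : Algebra.trace K L (e * e) = 0) (hef : Algebra.trace K L (e * f) = 1)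
    (hff : Algebra.trace K L (f * f) = 0) (heg : Algebra.trace K L (e * g) = 0)
    (hfg : Algebra.trace K L (f * g) = 0)
    {a : L} (ha0 : a ≠ 0) (ha : Algebra.trace K L (a ^ 2) = 0) :
    ∑ v : K × K, ψ (Algebra.trace K L (a * halfConeParam e f g v)) =
      (if ∃ v : K × K, v ≠ 0 ∧ halfConeParam e f g v = a then 1 else -1) *
        (complexQuadraticChar K 2 * Fintype.card K * gaussSum (complexQuadraticChar K) ψ) := by
  have h2 : (2 : K) ≠ 0 := Ring.two_ne_zero hK
  rw [trace_sq_eq_of_dual_basis hbasis] at ha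
  have hab := hbasis a
  have hmem : ∀ v : K × K, halfConeParam e f g v = a →
      Algebra.trace K L (a * f) = 2 * v.2 ^ 2 ∧ Algebra.trace K L (a * e) = v.1 ^ 2 := by
    rintro v rfl
    rw [mul_comm _ f, mul_comm _ e, trace_mul_halfConeParam, trace_mul_halfConeParam,
      hee, hef, mul_comm f e, hef, hff, heg, hfg]
    constructor <;> ring
  simp only [trace_mul_halfConeParam]
  rw [Fintype.sum_prod_type_right]
  dsimp only
  set P := Algebra.trace K L (a * e)
  set R := Algebra.trace K L (a * f)
  set S := Algebra.trace K L (a * g)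
  have hchar : ∀ c : K, c ≠ 0 →
      ((∃ v : K × K, v ≠ 0 ∧ halfConeParam e f g v = a) ↔ IsSquare (c * 2)) →
      complexQuadraticChar K c =
        (if ∃ v : K × K, v ≠ 0 ∧ halfConeParam e f g v = a then 1 else -1) *
          complexQuadraticChar K 2 := by
    intro c hc hiff
    have hc2 : complexQuadraticChar K (c * 2) =
        if ∃ v : K × K, v ≠ 0 ∧ halfConeParam e f g v = a then 1 else -1 := by
      split_ifs with h
      · exact complexQuadraticChar_of_isSquare (mul_ne_zero hc h2) (hiff.mp h)
      · exact complexQuadraticChar_of_not_isSquare (hiff.not.mp h)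
    rw [← hc2, map_mul, mul_assoc, complexQuadraticChar_mul_self h2, mul_one]
  by_cases hR : R = 0
  · have hS : S = 0 := by simpa [hR] using ha
    have hP : P ≠ 0 := fun hP => ha0 (by rw [hab, hR, hS, hP]; simp)
    rw [← mul_assoc, ← mul_assoc, ← hchar (2 * P) (mul_ne_zero h2 hP),
      ← sum_addChar_degenerate_binaryQuadraticForm hK hψ (B := 0) (C := 0) (mul_ne_zero h2 hP)
        (by simp), Finset.sum_comm]
    · simp only [hR, hS]
      refine Finset.sum_congr rfl fun s _ => Finset.sum_congr rfl fun t _ => ?_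
      ring_nf
    · constructor
      · rintro ⟨v, -, hv⟩
        exact ⟨2 * v.1, by rw [(hmem v hv).2]; ring⟩
      · rintro ⟨r, hr⟩
        refine ⟨(r / 2, 0), fun h => ?_, ?_⟩
        · have hr0 : r = 0 := by simpa [h2] using congrArg Prod.fst h
          exact mul_ne_zero (mul_ne_zero h2 hP) h2 (by rw [hr, hr0, mul_zero])
        · have hrP : (r / 2) ^ 2 = P := by
            field_simp
            linear_combination -hr
          rw [hab, hR, hS]
          simp [halfConeParam, hrP]
  · rw [← mul_assoc, ← mul_assoc, ← hchar R hR,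
      ← sum_addChar_degenerate_binaryQuadraticForm hK hψ (B := S) (C := 2 * P) hR ha]
    · refine Finset.sum_congr rfl fun t _ => Finset.sum_congr rfl fun s _ => ?_
      ring_nf
    · constructor
      · rintro ⟨v, -, hv⟩
        exact ⟨2 * v.2, by rw [(hmem v hv).1]; ring⟩
      · rintro ⟨r, hr⟩
        have hr0 : r ≠ 0 := fun h => mul_ne_zero hR h2 (by rw [hr, h, mul_zero])
        refine ⟨(-(S / r), r / 2), fun h => hr0 ?_, ?_⟩
        · simpa [h2] using congrArg Prod.snd h
        · have h1 : 2 * (r / 2) ^ 2 = R := by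
            field_simp
            linear_combination -hr
          have h3 : (-(S / r)) ^ 2 = P := by
            field_simp
            linear_combination P * hr - ha
          have h4 : 2 * (-(S / r)) * (r / 2) = -S := by field_simp
          rw [halfConeParam, h1, h3, h4, neg_smul, ← sub_eq_add_neg]
          exact hab.symm

end Main

theorem isPrimitive_of_eq_exp_trace {p : ℕ} (hp : p.Prime) {K : Type*} [Field K] [Fintype K]
    [Algebra (ZMod p) K] {ψ : AddChar K ℂ}
    (hψ : ∀ x : K, ψ x = Complex.exp (2 * Real.pi * Complex.I *
      ((Algebra.trace (ZMod p) K x).val : ℂ) / p)) : ψ.IsPrimitive := by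
  have : Fact p.Prime := ⟨hp⟩
  have : Fact (1 < p) := ⟨hp.one_lt⟩
  refine AddChar.IsPrimitive.of_ne_one fun h => ?_
  obtain ⟨x, hx⟩ := Algebra.trace_surjective (ZMod p) K 1
  have hx1 := hψ x
  rw [h, hx, ZMod.val_one, Nat.cast_one, mul_one] at hx1
  exact (Complex.isPrimitiveRoot_exp p hp.ne_zero).ne_one hp.one_lt hx1.symm

/-- **Theorem 3.6.** Let `q` be an odd prime power and let `y₀` be a point of the conic
`Tr_{q^3/q}(y²) = 0`. The half-cone
`D₁,₁ = {μ²·y·Tr(y₀y) : μ ∈ F_q^×, Tr(y²) = 0, Tr(y₀y) ≠ 0} ∪ {2μ²y₀ : μ ∈ F_q^×}`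
takes exactly the four prescribed nontrivial canonical additive character values, expressed
in terms of the quadratic character `η` of `F_q` and its Gauss sum. -/
theorem half_cone_character_values
    (p n q : ℕ) (hp : p.Prime) (hn : 0 < n) (hqpn : q = p ^ n) (hqodd : Odd q)
    (K M3 : Type) [Field K] [Fintype K] [Field M3] [Fintype M3] [Algebra K M3]
    [Algebra (ZMod p) K] [Algebra (ZMod p) M3]
    (hK : Fintype.card K = q) (hM3 : Fintype.card M3 = q ^ 3)
    (y₀ : M3) (hy₀ : y₀ ≠ 0) (hy₀conic : Algebra.trace K M3 (y₀ ^ 2) = 0)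
    (η : MulChar K ℂ) (hη : orderOf η = 2)
    (ψK : AddChar K ℂ) (hψK : ∀ x : K, ψK x = Complex.exp (2 * Real.pi * Complex.I *
      ((Algebra.trace (ZMod p) K x).val : ℂ) / p))
    (D11 : Set M3)
    (hD11 : ∀ x : M3, x ∈ D11 ↔
      ((∃ μ : K, μ ≠ 0 ∧ ∃ y : M3, y ≠ 0 ∧ Algebra.trace K M3 (y ^ 2) = 0 ∧
          Algebra.trace K M3 (y₀ * y) ≠ 0 ∧
          x = algebraMap K M3 (μ ^ 2) * y * algebraMap K M3 (Algebra.trace K M3 (y₀ * y))) ∨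
        (∃ μ : K, μ ≠ 0 ∧ x = 2 * algebraMap K M3 (μ ^ 2) * y₀))) :
    ∀ a : M3, a ≠ 0 →
      (Algebra.trace K M3 (a ^ 2) = 0 → a ∈ D11 →
        (∑ x ∈ Finset.univ.filter (· ∈ D11), Complex.exp (2 * Real.pi * Complex.I *
            ((Algebra.trace (ZMod p) M3 (a * x)).val : ℂ) / p)) =
          (-1 + η 2 * q * gaussSum η ψK) / 2) ∧
      (Algebra.trace K M3 (a ^ 2) = 0 → a ∉ D11 →
        (∑ x ∈ Finset.univ.filter (· ∈ D11), Complex.exp (2 * Real.pi * Complex.I *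
            ((Algebra.trace (ZMod p) M3 (a * x)).val : ℂ) / p)) =
          (-1 - η 2 * q * gaussSum η ψK) / 2) ∧
      (Algebra.trace K M3 (a ^ 2) ≠ 0 → IsSquare (Algebra.trace K M3 (a ^ 2)) →
        (∑ x ∈ Finset.univ.filter (· ∈ D11), Complex.exp (2 * Real.pi * Complex.I *
            ((Algebra.trace (ZMod p) M3 (a * x)).val : ℂ) / p)) =
          (-1 + (if q % 4 = 1 then (1 : ℂ) else -1) * q) / 2) ∧
      (¬ IsSquare (Algebra.trace K M3 (a ^ 2)) →
        (∑ x ∈ Finset.univ.filter (· ∈ D11), Complex.exp (2 * Real.pi * Complex.I *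
            ((Algebra.trace (ZMod p) M3 (a * x)).val : ℂ) / p)) =
          (-1 - (if q % 4 = 1 then (1 : ℂ) else -1) * q) / 2) := by
  have : Fact p.Prime := ⟨hp⟩
  have : IsScalarTower (ZMod p) K M3 :=
    IsScalarTower.of_algebraMap_eq' (Subsingleton.elim _ _)
  subst hK
  have hchar : ringChar K ≠ 2 := fun h =>
    Nat.not_even_iff_odd.mpr hqodd (Nat.even_iff.mpr (FiniteField.even_card_of_char_two h))
  have h2 : (2 : K) ≠ 0 := Ring.two_ne_zero hchar
  have hprim := isPrimitive_of_eq_exp_trace hp hψK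
  obtain rfl : η = complexQuadraticChar K := MulChar.eq_quadraticChar_of_orderOf_eq_two hη
  rw [pow_two] at hy₀conic
  obtain ⟨f, g, hef, hff, heg, hfg, hgg, hbasis⟩ :=
    exists_trace_dual_basis h2 hM3 hy₀ hy₀conic
  have hD : ∀ x, x ∈ D11 ↔ ∃ v : K × K, v ≠ 0 ∧ halfConeParam y₀ f g v = x := fun x =>
    (hD11 x).trans (exists_halfConeParam_iff h2 hy₀conic hef hff heg hfg hgg hbasis x)
  have hneg : ∀ v : K × K, v = -v → v = 0 := by
    rintro ⟨s, t⟩ h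
    have hself : ∀ r : K, r = -r → r = 0 := fun r hr =>
      (mul_eq_zero.mp (show 2 * r = 0 by linear_combination hr)).resolve_left h2
    exact Prod.ext (hself s (congrArg Prod.fst h)) (hself t (congrArg Prod.snd h))
  intro a ha0
  have hsum := sum_comp_eq_add_two_mul_sum hneg
    (halfConeParam_eq_iff h2 hy₀conic hef hff heg hfg hgg) hD
    (fun x => ψK (Algebra.trace K M3 (a * x)))
  have hzero : halfConeParam y₀ f g (0 : K × K) = 0 := by simp [halfConeParam]
  rw [hzero, mul_zero, map_zero, AddChar.map_zero_eq_one] at hsum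
  simp only [← Algebra.trace_trace (R := ZMod p) (S := K) (T := M3), ← hψK]
  have hiso := sum_addChar_trace_mul_halfConeParam_of_eq_zero hchar hprim hbasis hy₀conic hef hff
    heg hfg ha0
  have haniso := sum_addChar_trace_mul_halfConeParam_of_ne_zero hchar hprim hbasis (a := a)
  rw [complexQuadraticChar_neg_one hchar] at haniso
  simp only [← hD] at hiso
  refine ⟨fun ha haD => ?_, fun ha haD => ?_, fun ha hsq => ?_, fun hsq => ?_⟩
  · have h := hiso ha
    rw [if_pos haD] at h
    linear_combination (h - hsum) / 2
  · have h := hiso ha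
    rw [if_neg haD] at h
    linear_combination (h - hsum) / 2
  · have h := haniso ha
    rw [complexQuadraticChar_of_isSquare ha hsq] at h
    linear_combination (h - hsum) / 2
  · have h := haniso fun h0 => hsq (h0 ▸ IsSquare.zero)
    rw [complexQuadraticChar_of_not_isSquare hsq] at h
    linear_combination (h - hsum) / 2
end

section
/- Let p be a prime, f a positive integer, and η a multiplicative character of F_{p^f} of order ℓ > 1 (so that ℓ divides p^f - 1). Then for every nontrivial multiplicative character χ of F_{p^f}, G_{F_{p^f}}(χ) = (G_{F_{p^f}}(χ^ℓ)/χ^ℓ(ℓ)) · Π_{i=1}^{ℓ-1} ( G_{F_{p^f}}(η^i) / G_{F_{p^f}}(χ·η^i) ), where χ^ℓ(ℓ) denotes the value of the character χ^ℓ at the element ℓ·1 of F_{p^f}. -/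
open scoped Classical

section

open Polynomial Module

/-- The characteristic polynomial over `F` of multiplication by `x` on a finite extension, as a
power of the minimal polynomial. -/
noncomputable def extCharpoly (F : Type*) {L : Type*} [Field F] [Field L] [Algebra F L] (x : L) :
    F[X] :=
  minpoly F x ^ (finrank F L / (minpoly F x).natDegree)

section

variable {F L : Type*} [Field F] [Field L] [Algebra F L] [Finite L]

theorem natDegree_minpoly_dvd_finrank (x : L) : (minpoly F x).natDegree ∣ finrank F L :=
  have : Module.Finite F L := .of_finite
  minpoly.degree_dvd (.of_finite F x)

theorem extCharpoly_monic (x : L) : (extCharpoly F x).Monic :=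
  have : Module.Finite F L := .of_finite
  (minpoly.monic (.of_finite F x)).pow _

theorem natDegree_extCharpoly (x : L) : (extCharpoly F x).natDegree = finrank F L := by
  rw [extCharpoly, natDegree_pow, Nat.div_mul_cancel (natDegree_minpoly_dvd_finrank x)]

theorem card_minpoly_eq [Fintype L] {P : F[X]} (hP : Irreducible P) (hm : P.Monic) :
    (Finset.univ.filter fun x : L => minpoly F x = P).card =
      if P.natDegree ∣ finrank F L then P.natDegree else 0 := by
  split_ifs with h
  · have : Fact (Irreducible P) := ⟨hP⟩
    have hd : finrank F (AdjoinRoot P) = P.natDegree := by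
      rw [(AdjoinRoot.powerBasis hP.ne_zero).finrank, AdjoinRoot.powerBasis_dim]
    rw [← hd] at h ⊢
    rw [← FiniteField.natCard_algHom_of_finrank_dvd h,
      Nat.card_congr (AdjoinRoot.equiv L F P hP.ne_zero), ← Fintype.card_subtype,
      ← Nat.card_eq_fintype_card]
    refine Nat.card_congr (Equiv.subtypeEquivRight fun x => ?_)
    rw [mem_aroots]
    constructor
    · rintro rfl
      exact ⟨hP.ne_zero, minpoly.aeval _ _⟩
    · exact fun hx => (minpoly.eq_of_irreducible_of_monic hP hx.2 hm).symm
  · rw [Finset.card_eq_zero, Finset.filter_eq_empty_iff]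
    rintro x - rfl
    exact h (natDegree_minpoly_dvd_finrank x)

end

section

variable {F : Type*} [Field F]

theorem pow_dvd_iff_le_count {P f : F[X]} (hf : f ≠ 0)
    (hP : P ∈ UniqueFactorizationMonoid.normalizedFactors f)
    (j : ℕ) : P ^ j ∣ f ↔ j ≤ (UniqueFactorizationMonoid.normalizedFactors f).count P := by
  have := UniqueFactorizationMonoid.emultiplicity_eq_count_normalizedFactors
    (UniqueFactorizationMonoid.irreducible_of_normalized_factor P hP) hf
  rw [UniqueFactorizationMonoid.normalize_normalized_factor P hP] at this
  rw [pow_dvd_iff_le_emultiplicity, this, Nat.cast_le]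

theorem sum_natDegree_mul_count {f : F[X]} (hf : f.Monic) :
    ∑ P ∈ (UniqueFactorizationMonoid.normalizedFactors f).toFinset,
      P.natDegree * (UniqueFactorizationMonoid.normalizedFactors f).count P = f.natDegree := by
  have h := UniqueFactorizationMonoid.prod_normalizedFactors_eq hf.ne_zero
  rw [hf.normalize_eq_self] at h
  conv_rhs => rw [← h]
  rw [natDegree_multiset_prod _ (UniqueFactorizationMonoid.zero_notMem_normalizedFactors f),
    Finset.sum_multiset_map_count]
  exact Finset.sum_congr rfl fun P _ => by rw [smul_eq_mul, mul_comm]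

theorem card_multiples {d v n : ℕ} (hd : 0 < d) (h : d * v ≤ n) :
    ((Finset.range n).filter fun k => d ∣ k + 1 ∧ (k + 1) / d ≤ v).card = v := by
  conv_rhs => rw [← Finset.card_range v]
  symm
  refine Finset.card_bij (fun j _ => d * (j + 1) - 1) ?_ ?_ ?_
  · intro j hj
    have hj : j + 1 ≤ v := Finset.mem_range.mp hj
    have h1 : d * (j + 1) ≤ d * v := Nat.mul_le_mul_left _ hj
    have h2 : 0 < d * (j + 1) := by positivity
    have h3 : d * (j + 1) - 1 + 1 = d * (j + 1) := by omega
    rw [Finset.mem_filter, h3, Nat.mul_div_cancel_left _ hd, Finset.mem_range]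
    exact ⟨by omega, dvd_mul_right _ _, hj⟩
  · intro a _ b _ hab
    have h2 : 0 < d * (a + 1) := by positivity
    have h3 : 0 < d * (b + 1) := by positivity
    have : d * (a + 1) = d * (b + 1) := by omega
    simpa using Nat.eq_of_mul_eq_mul_left hd this
  · intro k hk
    obtain ⟨_, ⟨j, hj⟩, hv⟩ := Finset.mem_filter.mp hk
    rw [hj, Nat.mul_div_cancel_left _ hd] at hv
    have : j ≠ 0 := by rintro rfl; simp at hj
    refine ⟨j - 1, Finset.mem_range.mpr (by omega), ?_⟩
    rw [Nat.sub_add_cancel (by omega), ← hj]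
    simp

variable (E : ℕ → Type*) [∀ k, Field (E k)] [∀ k, Fintype (E k)] [∀ k, Algebra F (E k)]

theorem sum_card_extCharpoly_dvd (hE : ∀ k, finrank F (E k) = k + 1) {f : F[X]} (hf : f.Monic) :
    ∑ k ∈ Finset.range f.natDegree,
      (Finset.univ.filter fun x : E k => extCharpoly F x ∣ f).card = f.natDegree := by
  set N := UniqueFactorizationMonoid.normalizedFactors f with hN
  have key (k : ℕ) : (Finset.univ.filter fun x : E k => extCharpoly F x ∣ f).card =
      ∑ P ∈ N.toFinset, if P.natDegree ∣ k + 1 ∧ (k + 1) / P.natDegree ≤ N.count P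
        then P.natDegree else 0 := by
    rw [Finset.card_eq_sum_card_fiberwise (f := fun x : E k => minpoly F x) (t := N.toFinset)]
    · refine Finset.sum_congr rfl fun P hP => ?_
      rw [Multiset.mem_toFinset] at hP
      have hirr := UniqueFactorizationMonoid.irreducible_of_normalized_factor P hP
      have hm : P.Monic := by
        rw [← UniqueFactorizationMonoid.normalize_normalized_factor P hP]
        exact monic_normalize hirr.ne_zero
      rw [Finset.filter_filter]
      have (x : E k) : (extCharpoly F x ∣ f ∧ minpoly F x = P) ↔
          ((k + 1) / P.natDegree ≤ N.count P ∧ minpoly F x = P) := by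
        refine and_congr_left ?_
        rintro rfl
        rw [extCharpoly, hE, pow_dvd_iff_le_count hf.ne_zero hP]
      simp_rw [this]
      by_cases hc : (k + 1) / P.natDegree ≤ N.count P
      · simp only [hc, true_and, and_true]
        rw [card_minpoly_eq hirr hm, hE]
      · simp [hc]
    · intro x hx
      have hx : extCharpoly F x ∣ f := by simpa using hx
      have : Module.Finite F (E k) := .of_finite
      have hi : IsIntegral F x := .of_finite F x
      have hd : minpoly F x ∣ f := by
        refine dvd_trans (dvd_pow_self _ ?_) hx
        refine (Nat.div_pos (Nat.le_of_dvd ?_ (natDegree_minpoly_dvd_finrank x))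
          (minpoly.natDegree_pos hi)).ne'
        rw [hE]; omega
      simp only [hN, Finset.mem_coe, Multiset.mem_toFinset]
      obtain ⟨q, hq, hassoc⟩ := UniqueFactorizationMonoid.exists_mem_normalizedFactors_of_dvd
        hf.ne_zero (minpoly.irreducible hi) hd
      have : minpoly F x = q := by
        rw [← (minpoly.monic hi).normalize_eq_self,
          ← UniqueFactorizationMonoid.normalize_normalized_factor q hq]
        exact normalize_eq_normalize_iff.mpr ⟨hassoc.dvd, hassoc.symm.dvd⟩
      rwa [this]
  simp_rw [key]
  rw [Finset.sum_comm]
  conv_rhs => rw [← sum_natDegree_mul_count hf]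
  refine Finset.sum_congr rfl fun P hP => ?_
  rw [Multiset.mem_toFinset] at hP
  have hirr := UniqueFactorizationMonoid.irreducible_of_normalized_factor P hP
  rw [← Finset.sum_filter, Finset.sum_const, smul_eq_mul, mul_comm,
    card_multiples hirr.natDegree_pos]
  rw [mul_comm, ← natDegree_pow]
  exact natDegree_le_of_dvd ((pow_dvd_iff_le_count hf.ne_zero hP _).mpr le_rfl) hf.ne_zero

end

section

variable {F : Type*} [Field F]

noncomputable instance [Finite F] (n : ℕ) : Fintype (MonicDegreeEq F n) :=
  have : Finite (MonicDegreeEq F n) := by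
    refine Finite.of_injective (fun (f : MonicDegreeEq F n) (i : Fin n) => f.1.coeff i) ?_
    intro f g h
    ext i
    rcases lt_trichotomy i n with hi | rfl | hi
    · exact congrFun h ⟨i, hi⟩
    · rw [f.2.1, g.2.1]
    · rw [f.2.2 i hi, g.2.2 i hi]
  Fintype.ofFinite _

theorem sum_monic_mul [Finite F] {M : Type*} [AddCommMonoid M] (φ : F[X] → M) {h : F[X]}
    (hm : h.Monic) {k j n : ℕ} (hk : h.natDegree = k) (hn : k + j = n) :
    ∑ g : MonicDegreeEq F j, φ (h * g.1) =
      ∑ f : MonicDegreeEq F n, if h ∣ f.1 then φ f.1 else 0 := by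
  rw [← Finset.sum_filter]
  refine Finset.sum_bij (fun g _ => MonicDegreeEq.mk (h * g.1) (hm.mul g.monic)
    (by rw [hm.natDegree_mul g.monic, hk, g.natDegree, hn])) ?_ ?_ ?_ ?_
  · intro g _
    simp
  · intro a _ b _ hab
    exact Subtype.ext (mul_left_cancel₀ hm.ne_zero (congrArg Subtype.val hab))
  · intro f hf
    obtain ⟨g, hg⟩ : h ∣ f.1 := by simpa using hf
    have hgm : g.Monic := hm.of_mul_monic_left (hg ▸ f.monic)
    have hd := f.natDegree
    rw [hg, hm.natDegree_mul hgm] at hd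
    exact ⟨MonicDegreeEq.mk g hgm (by omega), Finset.mem_univ _, Subtype.ext hg.symm⟩
  · intro g _
    rfl

variable [Finite F] (E : ℕ → Type*) [∀ k, Field (E k)] [∀ k, Fintype (E k)] [∀ k, Algebra F (E k)]

/-- The logarithmic derivative of the generating series of a multiplicative function on monic
polynomials over a finite field, in terms of sums over extensions. -/
theorem mul_sum_monic (hE : ∀ k, finrank F (E k) = k + 1) (φ : F[X] → ℂ)
    (hφ : ∀ f g : F[X], f.Monic → g.Monic → φ (f * g) = φ f * φ g) (n : ℕ) :
    (n : ℂ) * ∑ f : MonicDegreeEq F n, φ f.1 =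
      ∑ k ∈ Finset.range n, (∑ x : E k, φ (extCharpoly F x)) *
        ∑ g : MonicDegreeEq F (n - 1 - k), φ g.1 := by
  have h1 : ∀ k ∈ Finset.range n, (∑ x : E k, φ (extCharpoly F x)) *
      ∑ g : MonicDegreeEq F (n - 1 - k), φ g.1 =
      ∑ f : MonicDegreeEq F n, ∑ x : E k, if extCharpoly F x ∣ f.1 then φ f.1 else 0 := by
    intro k hk
    rw [Finset.mem_range] at hk
    rw [Finset.sum_mul, Finset.sum_comm]
    refine Finset.sum_congr rfl fun x _ => ?_
    rw [← sum_monic_mul φ (extCharpoly_monic x) ((natDegree_extCharpoly x).trans (hE k))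
      (j := n - 1 - k) (by omega), Finset.mul_sum]
    exact Finset.sum_congr rfl fun g _ => (hφ _ _ (extCharpoly_monic x) g.monic).symm
  rw [Finset.sum_congr rfl h1, Finset.sum_comm, Finset.mul_sum]
  refine Finset.sum_congr rfl fun f _ => ?_
  have := sum_card_extCharpoly_dvd E hE f.monic
  rw [f.natDegree] at this
  simp_rw [← Finset.sum_filter, Finset.sum_const, nsmul_eq_mul]
  rw [← Finset.sum_mul, ← Nat.cast_sum, this]

/-- The generating series of a function over monic polynomials. -/
noncomputable def monicSeries (φ : F[X] → ℂ) : PowerSeries ℂ :=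
  .mk fun n => ∑ f : MonicDegreeEq F n, φ f.1

theorem derivative_monicSeries (hE : ∀ k, finrank F (E k) = k + 1) (φ : F[X] → ℂ)
    (hφ : ∀ f g : F[X], f.Monic → g.Monic → φ (f * g) = φ f * φ g) :
    PowerSeries.derivative ℂ (monicSeries φ) =
      .mk (fun k => ∑ x : E k, φ (extCharpoly F x)) * monicSeries φ := by
  ext n
  rw [PowerSeries.coeff_derivative, PowerSeries.coeff_mul,
    Finset.Nat.sum_antidiagonal_eq_sum_range_succ_mk, mul_comm]
  simpa [monicSeries] using mul_sum_monic E hE φ hφ (n + 1)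

theorem constantCoeff_monicSeries {φ : F[X] → ℂ} (h : φ 1 = 1) :
    PowerSeries.constantCoeff (monicSeries φ) = 1 := by
  rw [← PowerSeries.coeff_zero_eq_constantCoeff_apply, monicSeries, PowerSeries.coeff_mk]
  have (f : MonicDegreeEq F 0) : f.1 = 1 := f.monic.natDegree_eq_zero.mp f.natDegree
  have hs : Subsingleton (MonicDegreeEq F 0) :=
    ⟨fun f g => Subtype.ext ((this f).trans (this g).symm)⟩
  rw [Fintype.sum_subsingleton _ (MonicDegreeEq.mk 1 monic_one natDegree_one)]
  exact h

end

theorem powerSeries_eq_of_derivative_eq {A B S : PowerSeries ℂ}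
    (hA : PowerSeries.derivative ℂ A = S * A) (hB : PowerSeries.derivative ℂ B = S * B)
    (h : PowerSeries.constantCoeff A = PowerSeries.constantCoeff B) : A = B := by
  have key : ∀ n, ∀ m ≤ n, PowerSeries.coeff m A = PowerSeries.coeff m B := by
    intro n
    induction n with
    | zero => intro m hm; obtain rfl : m = 0 := by omega
              simpa using h
    | succ n ih =>
      intro m hm
      rcases Nat.lt_or_ge m (n + 1) with h' | h'
      · exact ih m (by omega)
      obtain rfl : m = n + 1 := by omega
      have hn : ((n : ℂ) + 1) ≠ 0 := by exact_mod_cast n.succ_ne_zero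
      apply mul_right_cancel₀ hn
      rw [← PowerSeries.coeff_derivative, ← PowerSeries.coeff_derivative, hA, hB,
        PowerSeries.coeff_mul, PowerSeries.coeff_mul]
      refine Finset.sum_congr rfl fun x hx => ?_
      rw [ih x.2 (by have := Finset.HasAntidiagonal.mem_antidiagonal.mp hx; omega)]
  ext n
  exact key n n le_rfl

theorem derivative_prod_eq {ι : Type*} (s : Finset ι) (A S : ι → PowerSeries ℂ)
    (h : ∀ i ∈ s, PowerSeries.derivative ℂ (A i) = S i * A i) :
    PowerSeries.derivative ℂ (∏ i ∈ s, A i) = (∑ i ∈ s, S i) * ∏ i ∈ s, A i := by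
  induction s using Finset.induction_on with
  | empty => simp
  | insert a s ha ih =>
    rw [Finset.prod_insert ha, Finset.sum_insert ha, Derivation.leibniz,
      ih fun i hi => h i (Finset.mem_insert_of_mem hi), h a (Finset.mem_insert_self _ _)]
    simp only [smul_eq_mul]
    ring

section

variable {F : Type*} [Field F]

/-- The sum of the `m`-th powers of the roots of a monic polynomial, read off from the logarithmic
derivative of the reversed polynomial. -/
noncomputable def rootPowerSum (m : ℕ) (f : F[X]) : F :=
  -PowerSeries.coeff m (PowerSeries.X * PowerSeries.derivative F (f.reverse : PowerSeries F) *
    (f.reverse : PowerSeries F)⁻¹)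

theorem constantCoeff_reverse {f : F[X]} (hf : f.Monic) :
    PowerSeries.constantCoeff (f.reverse : PowerSeries F) = 1 := by
  rw [← PowerSeries.coeff_zero_eq_constantCoeff_apply, coeff_coe, coeff_zero_reverse,
    hf.leadingCoeff]

theorem powerSeries_logDeriv_mul {u v : PowerSeries F} (hu : PowerSeries.constantCoeff u ≠ 0)
    (hv : PowerSeries.constantCoeff v ≠ 0) :
    PowerSeries.X * PowerSeries.derivative F (u * v) * (u * v)⁻¹ =
      PowerSeries.X * PowerSeries.derivative F u * u⁻¹ +
      PowerSeries.X * PowerSeries.derivative F v * v⁻¹ := by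
  have h1 := PowerSeries.mul_inv_cancel u hu
  have h2 := PowerSeries.mul_inv_cancel v hv
  rw [PowerSeries.mul_inv_rev, Derivation.leibniz, smul_eq_mul, smul_eq_mul]
  linear_combination PowerSeries.X * PowerSeries.derivative F v * v⁻¹ * h1 +
    PowerSeries.X * PowerSeries.derivative F u * u⁻¹ * h2

theorem rootPowerSum_mul (m : ℕ) {f g : F[X]} (hf : f.Monic) (hg : g.Monic) :
    rootPowerSum m (f * g) = rootPowerSum m f + rootPowerSum m g := by
  rw [rootPowerSum, rootPowerSum, rootPowerSum, reverse_mul_of_domain, coe_mul,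
    powerSeries_logDeriv_mul (by rw [constantCoeff_reverse hf]; exact one_ne_zero)
      (by rw [constantCoeff_reverse hg]; exact one_ne_zero), map_add, neg_add]

theorem rootPowerSum_one (m : ℕ) : rootPowerSum m (1 : F[X]) = 0 := by
  have := rootPowerSum_mul m (monic_one (R := F)) monic_one
  rw [one_mul] at this
  simpa using this

theorem rootPowerSum_map {K : Type*} [Field K] (i : F →+* K) (m : ℕ) {f : F[X]} (hf : f.Monic) :
    rootPowerSum m (f.map i) = i (rootPowerSum m f) := by
  have hr : ((f.map i).reverse : PowerSeries K) = PowerSeries.map i (f.reverse : PowerSeries F) := by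
    rw [← polynomial_map_coe]
    rw [reverse, reverse, natDegree_map, reflect_map]
  have hinv : (PowerSeries.map i (f.reverse : PowerSeries F))⁻¹ =
      PowerSeries.map i (f.reverse : PowerSeries F)⁻¹ := by
    rw [PowerSeries.inv_eq_iff_mul_eq_one, ← map_mul, PowerSeries.inv_mul_cancel, map_one]
    · rw [constantCoeff_reverse hf]; exact one_ne_zero
    · rw [← hr, constantCoeff_reverse (hf.map i)]; exact one_ne_zero
  have hd : PowerSeries.derivative K (PowerSeries.map i (f.reverse : PowerSeries F)) =
      PowerSeries.map i (PowerSeries.derivative F (f.reverse : PowerSeries F)) := by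
    ext n
    simp [PowerSeries.coeff_derivative]
  rw [rootPowerSum, hr, hinv, hd, ← PowerSeries.map_X i, ← map_mul, ← map_mul,
    PowerSeries.coeff_map, rootPowerSum, map_neg]

theorem rootPowerSum_add {m : ℕ} (hm : 0 < m) {f : F[X]} (hf : f.Monic) (hmf : m ≤ f.natDegree)
    (δ : F) :
    rootPowerSum m (f + C δ * X ^ (f.natDegree - m)) = rootPowerSum m f - m * δ := by
  set r : PowerSeries F := (f.reverse : PowerSeries F) with hr
  have hr1 : PowerSeries.constantCoeff r = 1 := constantCoeff_reverse hf
  have hr0 : PowerSeries.constantCoeff r ≠ 0 := by rw [hr1]; exact one_ne_zero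
  have hdeg : (f + C δ * X ^ (f.natDegree - m)).natDegree = f.natDegree := by
    apply natDegree_add_eq_left_of_natDegree_lt
    exact (natDegree_C_mul_X_pow_le _ _).trans_lt (by omega)
  have hrev : ((f + C δ * X ^ (f.natDegree - m)).reverse : PowerSeries F) =
      r + PowerSeries.C δ * PowerSeries.X ^ m := by
    rw [reverse, hdeg, reflect_add, reflect_C_mul_X_pow, revAt_le (by omega),
      Nat.sub_sub_self hmf, coe_add, coe_mul, coe_C, coe_pow, coe_X]
    rfl
  set g : PowerSeries F := PowerSeries.C δ * r⁻¹ with hg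
  have hu : r + PowerSeries.C δ * PowerSeries.X ^ m = r * (1 + PowerSeries.X ^ m * g) := by
    linear_combination (-PowerSeries.C δ * PowerSeries.X ^ m) * PowerSeries.mul_inv_cancel r hr0
  have hu1 : PowerSeries.constantCoeff (1 + PowerSeries.X ^ m * g) = 1 := by
    simp [hm.ne']
  have hu0 : PowerSeries.constantCoeff (1 + PowerSeries.X ^ m * g) ≠ 0 := by
    rw [hu1]; exact one_ne_zero
  have hd : PowerSeries.X * PowerSeries.derivative F (1 + PowerSeries.X ^ m * g) =
      PowerSeries.X ^ m * ((m : PowerSeries F) * g + PowerSeries.X * PowerSeries.derivative F g) := by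
    obtain ⟨k, rfl⟩ : ∃ k, m = k + 1 := ⟨m - 1, by omega⟩
    rw [map_add, Derivation.leibniz, Derivation.leibniz_pow]
    simp [PowerSeries.derivative_X]
    ring
  rw [rootPowerSum, hrev, hu, powerSeries_logDeriv_mul hr0 hu0, hd, map_add, neg_add,
    mul_assoc (PowerSeries.X ^ m)]
  have : PowerSeries.coeff m (PowerSeries.X ^ m *
      (((m : PowerSeries F) * g + PowerSeries.X * PowerSeries.derivative F g) *
        (1 + PowerSeries.X ^ m * g)⁻¹)) = m * δ := by
    have h0 := PowerSeries.coeff_X_pow_mul (((m : PowerSeries F) * g +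
      PowerSeries.X * PowerSeries.derivative F g) * (1 + PowerSeries.X ^ m * g)⁻¹) m 0
    rw [zero_add] at h0
    rw [h0, PowerSeries.coeff_zero_eq_constantCoeff_apply, map_mul,
      PowerSeries.constantCoeff_inv, hu1, inv_one, mul_one]
    simp [hg, hr1]
  rw [this, sub_eq_add_neg]
  rfl

theorem rootPowerSum_X_sub_C {m : ℕ} (hm : 0 < m) (a : F) : rootPowerSum m (X - C a) = a ^ m := by
  have hr : ((X - C a : F[X]).reverse : PowerSeries F) = 1 - PowerSeries.C a * PowerSeries.X := by
    rw [reverse, natDegree_X_sub_C, reflect_sub, reflect_one_X, reflect_C]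
    simp
  obtain ⟨k, rfl⟩ : ∃ k, m = k + 1 := ⟨m - 1, by omega⟩
  have hinv : (1 - PowerSeries.C a * PowerSeries.X : PowerSeries F)⁻¹ = .mk fun n => a ^ n := by
    rw [PowerSeries.inv_eq_iff_mul_eq_one (by simp)]
    ext n
    rw [mul_sub, mul_one, ← mul_assoc, map_sub, mul_comm _ (PowerSeries.C a)]
    rcases n with _ | n
    · simp
    · rw [PowerSeries.coeff_succ_mul_X, PowerSeries.coeff_C_mul]
      simp [pow_succ', PowerSeries.coeff_one]
  have hd : PowerSeries.derivative F (1 - PowerSeries.C a * PowerSeries.X : PowerSeries F) =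
      -PowerSeries.C a := by
    rw [map_sub, Derivation.leibniz]
    simp [PowerSeries.derivative_X]
  rw [rootPowerSum, hr, hinv, hd, mul_assoc, mul_comm, PowerSeries.coeff_succ_mul_X, neg_mul,
    map_neg, PowerSeries.coeff_C_mul, PowerSeries.coeff_mk, neg_neg, pow_succ']

theorem rootPowerSum_pow (m : ℕ) {f : F[X]} (hf : f.Monic) (n : ℕ) :
    rootPowerSum m (f ^ n) = n * rootPowerSum m f := by
  induction n with
  | zero => simp [rootPowerSum_one]
  | succ n ih =>
    rw [pow_succ, rootPowerSum_mul m (hf.pow n) hf, ih]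
    push_cast; ring

theorem rootPowerSum_multiset_prod {m : ℕ} (hm : 0 < m) (s : Multiset F) :
    rootPowerSum m (s.map fun a => X - C a).prod = (s.map fun a => a ^ m).sum := by
  induction s using Multiset.induction_on with
  | empty => simp [rootPowerSum_one]
  | cons a s ih =>
    rw [Multiset.map_cons, Multiset.prod_cons, rootPowerSum_mul m (monic_X_sub_C a)
      (monic_multiset_prod_of_monic _ _ fun b _ => monic_X_sub_C b), ih,
      rootPowerSum_X_sub_C hm, Multiset.map_cons, Multiset.sum_cons]

end

section

variable {F L : Type*} [Field F] [Field L] [Algebra F L] [Finite L]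

theorem minpoly_natDegree_mul_finrank (x : L) :
    finrank (IntermediateField.adjoin F {x}) L = finrank F L / (minpoly F x).natDegree := by
  have : Module.Finite F L := .of_finite
  have hi : IsIntegral F x := .of_finite F x
  rw [← IntermediateField.adjoin.finrank hi,
    ← Module.finrank_mul_finrank F (IntermediateField.adjoin F {x}) L,
    Nat.mul_div_cancel_left _ Module.finrank_pos]

theorem norm_eq_coeff_extCharpoly (x : L) :
    Algebra.norm F x = (-1) ^ (extCharpoly F x).natDegree * (extCharpoly F x).coeff 0 := by
  have : Module.Finite F L := .of_finite
  have hi : IsIntegral F x := .of_finite F x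
  rw [Algebra.norm_eq_norm_adjoin, extCharpoly, minpoly_natDegree_mul_finrank,
    coeff_zero_eq_eval_zero, eval_pow, natDegree_pow, mul_comm (_ / _), pow_mul, ← mul_pow]
  congr 1
  have := Algebra.PowerBasis.norm_gen_eq_coeff_zero_minpoly (IntermediateField.adjoin.powerBasis hi)
  rw [IntermediateField.adjoin.powerBasis_gen, IntermediateField.minpoly_gen] at this
  rw [this, coeff_zero_eq_eval_zero, IntermediateField.adjoin.powerBasis_dim]

theorem trace_pow_eq_rootPowerSum {m : ℕ} (hm : 0 < m) (x : L) :
    Algebra.trace F L (x ^ m) = rootPowerSum m (extCharpoly F x) := by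
  have : Finite F := Finite.of_injective _ (algebraMap F L).injective
  have : Module.Finite F L := .of_finite
  have hi : IsIntegral F x := .of_finite F x
  rw [extCharpoly, rootPowerSum_pow m (minpoly.monic hi), ← minpoly_natDegree_mul_finrank]
  set K := IntermediateField.adjoin F {x}
  have hx : x ^ m = algebraMap K L (IntermediateField.AdjoinSimple.gen F x ^ m) := by
    simp [K]
  rw [hx, ← Algebra.trace_trace (S := K), Algebra.trace_algebraMap, map_nsmul, nsmul_eq_mul]
  congr 1
  let Ω := AlgebraicClosure F
  apply (algebraMap F Ω).injective
  rw [trace_eq_sum_embeddings Ω, ← rootPowerSum_map _ m (minpoly.monic hi)]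
  have hs := (IsAlgClosed.splits ((minpoly F x).map (algebraMap F Ω)))
  rw [hs.eq_prod_roots_of_monic ((minpoly.monic hi).map _), rootPowerSum_multiset_prod hm]
  have hnd : ((minpoly F x).map (algebraMap F Ω)).roots.Nodup :=
    nodup_roots ((PerfectField.separable_of_irreducible (minpoly.irreducible hi)).map)
  rw [← Multiset.toFinset_val ((minpoly F x).map (algebraMap F Ω)).roots |>.trans
    (Multiset.dedup_eq_self.mpr hnd)]
  change _ = ∑ a ∈ ((minpoly F x).map (algebraMap F Ω)).roots.toFinset, a ^ m
  refine Finset.sum_bij (fun σ _ => σ (IntermediateField.AdjoinSimple.gen F x)) ?_ ?_ ?_ ?_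
  · intro σ _
    rw [Multiset.mem_toFinset, mem_roots ((minpoly.monic hi).map _).ne_zero, IsRoot.def,
      eval_map_algebraMap, aeval_algHom_apply, IntermediateField.aeval_gen_minpoly, map_zero]
  · intro σ _ τ _ h
    apply (IntermediateField.adjoin.powerBasis hi).algHom_ext
    rwa [IntermediateField.adjoin.powerBasis_gen]
  · intro a ha
    exact ⟨_, Finset.mem_univ _, IntermediateField.algHomAdjoinIntegralEquiv_symm_apply_gen F hi
      ⟨a, Multiset.mem_toFinset.mp ha⟩⟩
  · intro σ _
    simp

end

section

variable {F : Type*} [Field F]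

/-- The weight `χ(product of the roots) ψ(sum of the m-th powers of the roots)` of a polynomial. -/
noncomputable def charWeight (χ : MulChar F ℂ) (ψ : AddChar F ℂ) (m : ℕ) (f : F[X]) : ℂ :=
  χ ((-1) ^ f.natDegree * f.coeff 0) * ψ (rootPowerSum m f)

theorem charWeight_mul (χ : MulChar F ℂ) (ψ : AddChar F ℂ) (m : ℕ) (f g : F[X])
    (hf : f.Monic) (hg : g.Monic) :
    charWeight χ ψ m (f * g) = charWeight χ ψ m f * charWeight χ ψ m g := by
  rw [charWeight, charWeight, charWeight, rootPowerSum_mul m hf hg, AddChar.map_add_eq_mul,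
    hf.natDegree_mul hg, mul_coeff_zero, pow_add, mul_mul_mul_comm, map_mul, mul_mul_mul_comm]

theorem charWeight_one (χ : MulChar F ℂ) (ψ : AddChar F ℂ) (m : ℕ) :
    charWeight χ ψ m 1 = 1 := by
  simp [charWeight, rootPowerSum_one]

theorem charWeight_extCharpoly {L : Type*} [Field L] [Algebra F L] [Finite L] (χ : MulChar F ℂ)
    (ψ : AddChar F ℂ) {m : ℕ} (hm : 0 < m) (x : L) :
    charWeight χ ψ m (extCharpoly F x) =
      χ (Algebra.norm F x) * ψ (Algebra.trace F L (x ^ m)) := by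
  rw [charWeight, ← norm_eq_coeff_extCharpoly, ← trace_pow_eq_rootPowerSum hm]

/-- Adding `c X ^ j` to a monic polynomial of degree `n > j`. -/
noncomputable def addMonomial {n j : ℕ} (hj : j < n) (c : F) :
    MonicDegreeEq F n ≃ MonicDegreeEq F n where
  toFun f := ⟨f.1 + C c * X ^ j, by simp [f.2.1, coeff_X_pow, hj.ne'], fun i hi => by
    simp [f.2.2 i hi, coeff_X_pow, (hj.trans hi).ne']⟩
  invFun f := ⟨f.1 + C (-c) * X ^ j, by simp [f.2.1, coeff_X_pow, hj.ne'], fun i hi => by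
    simp [f.2.2 i hi, coeff_X_pow, (hj.trans hi).ne']⟩
  left_inv f := by ext1; simp
  right_inv f := by ext1; simp

theorem rootPowerSum_addMonomial {m n : ℕ} (hm : 0 < m) (hn : m ≤ n) (hj : n - m < n) (c : F)
    (f : MonicDegreeEq F n) :
    rootPowerSum m (addMonomial hj c f).1 = rootPowerSum m f.1 - m * c := by
  have := rootPowerSum_add hm f.monic (by rwa [f.natDegree]) c
  rwa [f.natDegree] at this

theorem sum_charWeight_eq_zero [Finite F] (χ : MulChar F ℂ) {ψ : AddChar F ℂ} (hψ : ψ ≠ 1) {n : ℕ}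
    (hn : 1 < n) : ∑ f : MonicDegreeEq F n, charWeight χ ψ 1 f.1 = 0 := by
  obtain ⟨c, hc⟩ := AddChar.ne_one_iff.mp hψ
  have hj : n - 1 < n := by omega
  have key : ψ c * ∑ f : MonicDegreeEq F n, charWeight χ ψ 1 f.1 =
      ∑ f : MonicDegreeEq F n, charWeight χ ψ 1 f.1 := by
    conv_rhs => rw [← (addMonomial hj (-c)).sum_comp]
    rw [Finset.mul_sum]
    refine Finset.sum_congr rfl fun f _ => ?_
    rw [charWeight, charWeight, rootPowerSum_addMonomial one_pos hn.le, MonicDegreeEq.natDegree,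
      MonicDegreeEq.natDegree]
    have : (addMonomial hj (-c) f).1.coeff 0 = f.1.coeff 0 := by
      simp [addMonomial, coeff_X_pow, (show 0 ≠ n - 1 by omega)]
    rw [this, Nat.cast_one, one_mul, sub_neg_eq_add, AddChar.map_add_eq_mul]
    ring
  by_contra h
  exact hc (mul_right_cancel₀ h (key.trans (one_mul _).symm))

theorem sum_charWeight_degree [Fintype F] {n : ℕ} (hn : 0 < n) (ψ : AddChar F ℂ) :
    ∃ C : ℂ, ∀ χ : MulChar F ℂ, ∑ f : MonicDegreeEq F n, charWeight χ ψ n f.1 =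
      C * ∑ c : F, χ ((-1) ^ n * c) * ψ (-(n * c)) := by
  refine ⟨∑ f : MonicDegreeEq F n with f.1.coeff 0 = 0, ψ (rootPowerSum n f.1), fun χ => ?_⟩
  have hj : n - n < n := by omega
  rw [← Finset.sum_fiberwise _ (fun f : MonicDegreeEq F n => f.1.coeff 0), Finset.mul_sum]
  refine Finset.sum_congr rfl fun c _ => ?_
  rw [Finset.sum_mul]
  symm
  have hcoeff (f : MonicDegreeEq F n) (c : F) :
      (addMonomial hj c f).1.coeff 0 = f.1.coeff 0 + c := by
    simp [addMonomial]
  refine Finset.sum_equiv (addMonomial hj c) ?_ ?_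
  · intro f
    simp only [Finset.mem_filter, Finset.mem_univ, true_and]
    rw [hcoeff, add_eq_right]
  · intro f hf
    have hf : f.1.coeff 0 = 0 := by simpa using hf
    rw [charWeight, rootPowerSum_addMonomial hn le_rfl, hcoeff, hf, zero_add,
      MonicDegreeEq.natDegree, sub_eq_add_neg, AddChar.map_add_eq_mul]
    ring

theorem sum_charWeight_one [Fintype F] (χ : MulChar F ℂ) (ψ : AddChar F ℂ) :
    ∑ f : MonicDegreeEq F 1, charWeight χ ψ 1 f.1 = gaussSum χ ψ := by
  rw [gaussSum]
  symm
  refine Finset.sum_bij (fun a _ => MonicDegreeEq.mk (X - C a) (monic_X_sub_C a)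
    (natDegree_X_sub_C a)) (fun _ _ => Finset.mem_univ _) ?_ ?_ ?_
  · intro a _ b _ h
    simpa using congrArg Subtype.val h
  · intro f _
    refine ⟨-f.1.coeff 0, Finset.mem_univ _, Subtype.ext ?_⟩
    have := f.monic.eq_X_add_C f.natDegree
    simp only [MonicDegreeEq.mk_coe, map_neg, sub_neg_eq_add]
    exact this.symm
  · intro a _
    simp [charWeight, rootPowerSum_X_sub_C]

theorem monicSeries_charWeight_one [Fintype F] (χ : MulChar F ℂ) {ψ : AddChar F ℂ} (hψ : ψ ≠ 1) :
    monicSeries (charWeight χ ψ 1) = ((1 + C (gaussSum χ ψ) * X : ℂ[X]) : PowerSeries ℂ) := by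
  ext n
  rw [coeff_coe]
  rcases n with _ | _ | n
  · simpa using constantCoeff_monicSeries (charWeight_one χ ψ 1)
  · rw [monicSeries, PowerSeries.coeff_mk, zero_add, sum_charWeight_one]
    simp [coeff_one]
  · rw [monicSeries, PowerSeries.coeff_mk, sum_charWeight_eq_zero χ hψ (by omega)]
    simp [coeff_one]

end

section

variable {F L : Type*} [Field F] [Field L] [Fintype L] [Algebra F L]

theorem sum_pow_norm_eq_card {η : MulChar F ℂ} {ℓ : ℕ} (hη : orderOf η = ℓ) (hℓ : 0 < ℓ) {x : L}
    (hx : x ≠ 0) :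
    ∑ i ∈ Finset.range ℓ, (η ^ i) (Algebra.norm F x) =
      ((Finset.univ.filter fun y : L => y ^ ℓ = x).card : ℂ) := by
  have hN : Algebra.norm F x ≠ 0 := Algebra.norm_ne_zero_iff.mpr hx
  obtain ⟨g, hg⟩ := IsCyclic.exists_generator (α := Lˣ)
  set u : Fˣ := Units.map (Algebra.norm F) g with hu
  have hgen : ∀ v : Fˣ, v ∈ Subgroup.zpowers u := by
    intro v
    obtain ⟨w, rfl⟩ := FiniteField.unitsMap_norm_surjective F L v
    obtain ⟨k, rfl⟩ := hg w
    exact ⟨k, by simp [hu]⟩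
  have hord : ∀ k : ℕ, η u ^ k = 1 → ℓ ∣ k := by
    intro k hk
    rw [← hη, orderOf_dvd_iff_pow_eq_one]
    apply (MulChar.eq_iff hgen _ _).mpr
    rw [MulChar.pow_apply_coe, hk, MulChar.one_apply_coe]
  have hηℓ : η ^ ℓ = 1 := by rw [← hη, pow_orderOf_eq_one]
  have hpow : η (Algebra.norm F x) ^ ℓ = 1 := by
    rw [← MulChar.pow_apply' _ hℓ.ne', hηℓ, MulChar.one_apply hN.isUnit]
  have hterm : ∀ i, (η ^ i) (Algebra.norm F x) = η (Algebra.norm F x) ^ i := fun i => by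
    have := MulChar.pow_apply_coe η i (Units.mk0 _ hN)
    simpa using this
  simp_rw [hterm]
  obtain ⟨k, hk⟩ := (mem_powers_iff_mem_zpowers.mpr (hg (Units.mk0 x hx)))
  have hk : g ^ k = Units.mk0 x hx := hk
  have hxk : Algebra.norm F x = ((u ^ k : Fˣ) : F) := by
    have := congrArg (fun w : Lˣ => Algebra.norm F (w : L)) hk
    simp only [Units.val_pow_eq_pow_val, map_pow, Units.val_mk0] at this
    rw [← this, hu]
    simp
  have hηk : η (Algebra.norm F x) = η u ^ k := by
    rw [hxk, Units.val_pow_eq_pow_val, map_pow]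
  have hdvd : ℓ ∣ Fintype.card Lˣ := by
    apply hord
    rw [← map_pow, ← Units.val_pow_eq_pow_val, hu, ← map_pow, pow_card_eq_one, map_one,
      Units.val_one, map_one]
  by_cases h1 : η (Algebra.norm F x) = 1
  · obtain ⟨j, rfl⟩ := hord k (hηk ▸ h1)
    simp only [h1, one_pow, Finset.sum_const, Finset.card_range, nsmul_eq_mul, mul_one]
    congr 1
    have hg0 : orderOf g = Fintype.card Lˣ := by
      rw [← Nat.card_eq_fintype_card]
      exact orderOf_eq_card_of_forall_mem_zpowers hg
    obtain ⟨d, hd⟩ := hdvd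
    have hprim : IsPrimitiveRoot (((g ^ d : Lˣ)) : L) ℓ := by
      rw [IsPrimitiveRoot.coe_units_iff]
      exact (IsPrimitiveRoot.orderOf g).pow (orderOf_pos g) (by rw [hg0, hd, mul_comm])
    have hroot : ((g ^ j : Lˣ) : L) ^ ℓ = x := by
      rw [← Units.val_pow_eq_pow_val, ← pow_mul, mul_comm, hk, Units.val_mk0]
    have hc := hprim.card_nthRoots x
    rw [if_pos ⟨_, hroot⟩] at hc
    have hset : (Finset.univ.filter fun y : L => y ^ ℓ = x) = (nthRoots ℓ x).toFinset := by
      ext y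
      simp [mem_nthRoots hℓ]
    rw [hset, Multiset.toFinset_card_of_nodup (hprim.nthRoots_nodup hx), hc]
  · have h0 : ∑ i ∈ Finset.range ℓ, η (Algebra.norm F x) ^ i = 0 := by
      rw [geom_sum_eq h1, hpow, sub_self, zero_div]
    rw [h0, eq_comm, Nat.cast_eq_zero, Finset.card_eq_zero, Finset.filter_eq_empty_iff]
    rintro y - rfl
    have hy : y ≠ 0 := by rintro rfl; exact hx (zero_pow hℓ.ne')
    have hNy : Algebra.norm F y ≠ 0 := Algebra.norm_ne_zero_iff.mpr hy
    apply h1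
    rw [map_pow, map_pow, ← MulChar.pow_apply' _ hℓ.ne', hηℓ, MulChar.one_apply hNy.isUnit]

theorem sum_charWeight_extCharpoly {η : MulChar F ℂ} {ℓ : ℕ} (hη : orderOf η = ℓ) (hℓ : 0 < ℓ)
    (χ : MulChar F ℂ) (ψ : AddChar F ℂ) :
    ∑ i ∈ Finset.range ℓ, ∑ x : L, charWeight (χ * η ^ i) ψ 1 (extCharpoly F x) =
      ∑ x : L, charWeight (χ ^ ℓ) ψ ℓ (extCharpoly F x) := by
  simp_rw [charWeight_extCharpoly _ ψ one_pos, charWeight_extCharpoly _ ψ hℓ]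
  rw [Finset.sum_comm]
  conv_rhs => rw [← Finset.sum_fiberwise Finset.univ (fun y : L => y ^ ℓ)]
  refine Finset.sum_congr rfl fun x _ => ?_
  have : ∀ y ∈ Finset.univ.filter (fun y : L => y ^ ℓ = x),
      (χ ^ ℓ) (Algebra.norm F y) * ψ (Algebra.trace F L (y ^ ℓ)) =
      χ (Algebra.norm F x) * ψ (Algebra.trace F L x) := by
    intro y hy
    obtain rfl : y ^ ℓ = x := by simpa using hy
    rw [MulChar.pow_apply' _ hℓ.ne', ← map_pow χ, ← map_pow (Algebra.norm F)]
  rw [Finset.sum_congr rfl this, Finset.sum_const, nsmul_eq_mul]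
  by_cases hx : x = 0
  · simp [hx, MulChar.map_zero]
  · rw [← sum_pow_norm_eq_card hη hℓ hx, Finset.sum_mul]
    refine Finset.sum_congr rfl fun i _ => ?_
    rw [pow_one, MulChar.mul_apply]
    ring

end

section

variable {F : Type*} [Field F] [Fintype F]

theorem prod_gaussSum_eq_sum_charWeight {η : MulChar F ℂ} {ℓ : ℕ} (hη : orderOf η = ℓ) (hℓ : 0 < ℓ)
    (χ : MulChar F ℂ) {ψ : AddChar F ℂ} (hψ : ψ ≠ 1) :
    ∏ i ∈ Finset.range ℓ, gaussSum (χ * η ^ i) ψ =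
      ∑ f : MonicDegreeEq F ℓ, charWeight (χ ^ ℓ) ψ ℓ f.1 := by
  obtain ⟨p, hp⟩ := CharP.exists F
  have : Fact p.Prime := ⟨CharP.char_is_prime F p⟩
  let E (k : ℕ) : Type _ := FiniteField.Extension F p (k + 1)
  let (k : ℕ) : Field (E k) := inferInstanceAs (Field (FiniteField.Extension F p (k + 1)))
  let (k : ℕ) : Algebra F (E k) := inferInstanceAs (Algebra F (FiniteField.Extension F p (k + 1)))
  have (k : ℕ) : Finite (E k) := inferInstanceAs (Finite (FiniteField.Extension F p (k + 1)))
  let (k : ℕ) : Fintype (E k) := Fintype.ofFinite _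
  have hE (k : ℕ) : finrank F (E k) = k + 1 := FiniteField.finrank_extension F p (k + 1)
  have key : ∏ i ∈ Finset.range ℓ, monicSeries (charWeight (χ * η ^ i) ψ 1) =
      monicSeries (charWeight (χ ^ ℓ) ψ ℓ) := by
    refine powerSeries_eq_of_derivative_eq
      (derivative_prod_eq _ _ _ fun i _ => derivative_monicSeries E hE _ (charWeight_mul _ ψ 1))
      (S := ∑ i ∈ Finset.range ℓ, .mk fun k => ∑ x : E k,
        charWeight (χ * η ^ i) ψ 1 (extCharpoly F x)) ?_ ?_
    · rw [derivative_monicSeries E hE _ (charWeight_mul _ ψ ℓ)]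
      congr 1
      ext k
      rw [map_sum]
      simp only [PowerSeries.coeff_mk]
      exact (sum_charWeight_extCharpoly hη hℓ χ ψ).symm
    · rw [map_prod, constantCoeff_monicSeries (charWeight_one _ ψ ℓ)]
      exact Finset.prod_eq_one fun i _ => constantCoeff_monicSeries (charWeight_one _ ψ 1)
  have hc := congrArg (PowerSeries.coeff ℓ) key
  simp_rw [monicSeries_charWeight_one _ hψ] at hc
  rw [monicSeries, PowerSeries.coeff_mk] at hc
  simp_rw [← coeToPowerSeries.ringHom_apply] at hc
  rw [← map_prod, coeToPowerSeries.ringHom_apply, coeff_coe] at hc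
  rw [← hc]
  have hcp := coeff_prod_of_natDegree_le (s := Finset.range ℓ)
    (fun i => (1 + C (gaussSum (χ * η ^ i) ψ) * X : ℂ[X])) 1 ?_
  · rw [Finset.card_range, mul_one] at hcp
    rw [hcp]
    exact Finset.prod_congr rfl fun i _ => by simp [coeff_one]
  · intro i _
    compute_degree

theorem sum_mulChar_neg_mul {χ : MulChar F ℂ} {ℓ : ℕ} (hℓ : (ℓ : F) ≠ 0) (ψ : AddChar F ℂ) :
    ∑ c : F, (χ ^ ℓ) ((-1) ^ ℓ * c) * ψ (-(ℓ * c)) = gaussSum (χ ^ ℓ) ψ / (χ ^ ℓ) (ℓ : F) := by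
  have hℓ0 : ℓ ≠ 0 := by rintro rfl; simp at hℓ
  have hne : (χ ^ ℓ) (ℓ : F) ≠ 0 := by
    have := (hℓ.isUnit.map (χ ^ ℓ)).ne_zero
    exact this
  rw [eq_div_iff hne, gaussSum, Finset.sum_mul]
  refine Fintype.sum_equiv (Equiv.mulLeft₀ (-(ℓ : F)) (neg_ne_zero.mpr hℓ)) _ _ fun c => ?_
  have hsign : (χ ^ ℓ) ((-1) ^ ℓ) = (χ ^ ℓ) (-1) := by
    rw [MulChar.pow_apply' _ hℓ0, MulChar.pow_apply' _ hℓ0, ← map_pow, ← map_pow, ← pow_mul]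
    rcases Nat.even_or_odd ℓ with h | h
    · rw [h.neg_one_pow, (h.mul_left ℓ).neg_one_pow]
    · rw [h.neg_one_pow, (h.mul h).neg_one_pow]
  change _ = (χ ^ ℓ) (-(ℓ : F) * c) * ψ (-(ℓ : F) * c)
  rw [neg_mul, ← neg_one_mul ((ℓ : F) * c), map_mul, map_mul (χ ^ ℓ),
    map_mul (χ ^ ℓ), hsign]
  ring

theorem natCast_orderOf_ne_zero (η : MulChar F ℂ) : ((orderOf η : ℕ) : F) ≠ 0 := by
  intro h
  obtain ⟨p, hp⟩ := CharP.exists F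
  have : Fact p.Prime := ⟨CharP.char_is_prime F p⟩
  obtain ⟨n, -, hn⟩ := FiniteField.card F p
  have h1 : p ∣ Fintype.card F - 1 :=
    ((CharP.cast_eq_zero_iff F p _).mp h).trans η.orderOf_dvd_card_sub_one
  have h2 : p ∣ Fintype.card F := hn ▸ dvd_pow_self p n.ne_zero
  have h3 := (Nat.dvd_sub_iff_right Fintype.card_pos h2).mp h1
  exact (CharP.char_is_prime F p).one_lt.ne' (Nat.dvd_one.mp h3)

theorem gaussSum_ne_zero_of_addChar_ne_one (χ : MulChar F ℂ) {ψ : AddChar F ℂ} (hψ : ψ ≠ 1) :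
    gaussSum χ ψ ≠ 0 := by
  by_cases hχ : χ = 1
  · rw [hχ, gaussSum_one_left hψ]
    exact neg_ne_zero.mpr one_ne_zero
  · exact gaussSum_ne_zero_of_nontrivial (by exact_mod_cast Fintype.card_ne_zero) hχ
      (AddChar.IsPrimitive.of_ne_one hψ)

theorem prod_range_eq_mul_prod_Icc {M : Type*} [CommMonoid M] (g : ℕ → M) {ℓ : ℕ} (hℓ : 0 < ℓ) :
    ∏ i ∈ Finset.range ℓ, g i = g 0 * ∏ i ∈ Finset.Icc 1 (ℓ - 1), g i := by
  obtain ⟨n, rfl⟩ : ∃ n, ℓ = n + 1 := ⟨ℓ - 1, by omega⟩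
  rw [Finset.range_eq_Ico, Finset.prod_eq_prod_Ico_succ_bot n.succ_pos]
  rfl

/-- The Davenport–Hasse product formula for a nontrivial additive character. -/
theorem gaussSum_eq_mul_prod {η : MulChar F ℂ} {ℓ : ℕ} (hη : orderOf η = ℓ) (hℓ : 0 < ℓ)
    (χ : MulChar F ℂ) {ψ : AddChar F ℂ} (hψ : ψ ≠ 1) :
    gaussSum χ ψ = (gaussSum (χ ^ ℓ) ψ / (χ ^ ℓ) (ℓ : F)) *
      ∏ i ∈ Finset.Icc 1 (ℓ - 1), (gaussSum (η ^ i) ψ / gaussSum (χ * η ^ i) ψ) := by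
  have hℓF : (ℓ : F) ≠ 0 := hη ▸ natCast_orderOf_ne_zero η
  obtain ⟨C, hC⟩ := sum_charWeight_degree hℓ ψ
  have h (χ : MulChar F ℂ) : gaussSum χ ψ * ∏ i ∈ Finset.Icc 1 (ℓ - 1), gaussSum (χ * η ^ i) ψ =
      C * (gaussSum (χ ^ ℓ) ψ / (χ ^ ℓ) (ℓ : F)) := by
    rw [← sum_mulChar_neg_mul hℓF, ← hC, ← prod_gaussSum_eq_sum_charWeight hη hℓ χ hψ,
      prod_range_eq_mul_prod_Icc _ hℓ, pow_zero, mul_one]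
  have h1 := h 1
  simp only [one_mul, one_pow, gaussSum_one_left hψ, MulChar.one_apply hℓF.isUnit, div_one] at h1
  have hCeq : ∏ i ∈ Finset.Icc 1 (ℓ - 1), gaussSum (η ^ i) ψ = C := by
    linear_combination -h1
  have hne : ∏ i ∈ Finset.Icc 1 (ℓ - 1), gaussSum (χ * η ^ i) ψ ≠ 0 :=
    Finset.prod_ne_zero_iff.mpr fun i _ => gaussSum_ne_zero_of_addChar_ne_one _ hψ
  rw [Finset.prod_div_distrib, hCeq, mul_div_assoc', eq_div_iff hne, h χ, mul_comm]

end

theorem addChar_ne_one_of_trace {p : ℕ} (hp : p.Prime) {F : Type*} [Field F] [Finite F]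
    [Algebra (ZMod p) F] {ψ : AddChar F ℂ}
    (hψ : ∀ x : F, ψ x = Complex.exp (2 * Real.pi * Complex.I *
      ((Algebra.trace (ZMod p) F x).val : ℂ) / p)) : ψ ≠ 1 := by
  have : Fact p.Prime := ⟨hp⟩
  have : Module.Finite (ZMod p) F := .of_finite
  obtain ⟨x, hx⟩ := Algebra.trace_surjective (ZMod p) F 1
  have h := hψ x
  rw [hx, ZMod.val_one, Nat.cast_one, mul_one] at h
  rintro rfl
  rw [AddChar.one_apply] at h
  exact (Complex.isPrimitiveRoot_exp p hp.ne_zero).ne_one hp.one_lt h.symm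

end

/-- **Theorem 2.6 (Davenport–Hasse product formula).** Let `η` be a multiplicative character
of `F_{p^f}` of order `ℓ > 1`. For every nontrivial multiplicative character `χ` of
`F_{p^f}`,
`G(χ) = (G(χ^ℓ)/χ^ℓ(ℓ)) · Π_{i=1}^{ℓ-1} G(η^i)/G(χη^i)`. -/
theorem davenport_hasse_product
    (p f : ℕ) (hp : p.Prime) (hf : 0 < f)
    (F : Type) [Field F] [Fintype F] [Algebra (ZMod p) F]
    (hF : Fintype.card F = p ^ f)
    (ℓ : ℕ) (hℓ : 1 < ℓ)
    (η : MulChar F ℂ) (hη : orderOf η = ℓ)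
    (χ : MulChar F ℂ) (hχ : χ ≠ 1)
    (ψF : AddChar F ℂ) (hψF : ∀ x : F, ψF x = Complex.exp (2 * Real.pi * Complex.I *
      ((Algebra.trace (ZMod p) F x).val : ℂ) / p)) :
    gaussSum χ ψF =
      (gaussSum (χ ^ ℓ) ψF / (χ ^ ℓ) ((ℓ : F))) *
        ∏ i ∈ Finset.Icc 1 (ℓ - 1), (gaussSum (η ^ i) ψF / gaussSum (χ * η ^ i) ψF) := by
  exact gaussSum_eq_mul_prod hη (zero_lt_one.trans hℓ) χ (addChar_ne_one_of_trace hp hψF)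
end
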